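/- M is a simple sl_2-module: every nonzero subspace of M that is invariant under the operators E_{-1}, E_0 and E_1 is equal to M. -/

import Mathlib

noncomputable section

/-- The basis vector `v_k` of the module `N(0)`. -/
def vv (K : Type*) [Field K] (k : ℤ) : (ℤ ⊕ ℤ) →₀ K := Finsupp.single (Sum.inl k) 1

/-- The basis vector `u_k` of the module `N(0)`. -/
def uu (K : Type*) [Field K] (k : ℤ) : (ℤ ⊕ ℤ) →₀ K := Finsupp.single (Sum.inr k) 1

/-- The smallest subspace of `N(0)` containing `v_0` and invariant under
`E_{-1}`, `E_0` and `E_1`. -/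
def Msub (K : Type*) [Field K]
    (E : ℤ → (((ℤ ⊕ ℤ) →₀ K) →ₗ[K] ((ℤ ⊕ ℤ) →₀ K))) :
    Submodule K ((ℤ ⊕ ℤ) →₀ K) :=
  sInf {W : Submodule K ((ℤ ⊕ ℤ) →₀ K) |
    vv K 0 ∈ W ∧ ∀ i ∈ ({-1, 0, 1} : Set ℤ), ∀ x ∈ W, E i x ∈ W}

section LadderBasis

variable {K V : Type*} [Field K] [AddCommGroup V] [Module K V]

/-- The descending half of the ladder: `f 0 = v` and `f (n + 1) = T (f n) - n • f n`. -/
def lowerLadder (T : V →ₗ[K] V) (v : V) : ℕ → V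
  | 0 => v
  | n + 1 => T (lowerLadder T v n) - (n : K) • lowerLadder T v n

theorem apply_lowerLadder_succ {P T : V →ₗ[K] V} {v : V}
    (hTP : ∀ x, T (P x) = P (T x) - P x) (hv : P (T v) = v) (n : ℕ) :
    P (lowerLadder T v (n + 1)) = lowerLadder T v n := by
  induction n with
  | zero => simp [lowerLadder, hv]
  | succ n ih =>
    have h : P (T (lowerLadder T v (n + 1))) =
        T (P (lowerLadder T v (n + 1))) + P (lowerLadder T v (n + 1)) := by
      rw [hTP]; abel
    rw [lowerLadder, map_sub, map_smul, h, ih, lowerLadder]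
    push_cast
    module

/-- If `[T, P] = -P` and `P T v = v`, then `v` extends to a `ℤ`-indexed family on which `P` acts
as the shift and `T` acts by `T e_k = e_{k-1} - k e_k`. -/
theorem exists_ladder {P T : V →ₗ[K] V} {v : V}
    (hTP : ∀ x, T (P x) = P (T x) - P x) (hv : P (T v) = v) :
    ∃ e : ℤ → V, e 0 = v ∧ (∀ k, P (e k) = e (k + 1)) ∧
      ∀ k : ℤ, T (e k) = e (k - 1) - (k : K) • e k := by
  obtain ⟨e, hpos, hneg⟩ : ∃ e : ℤ → V, (∀ n : ℕ, e n = (P ^ n) v) ∧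
      ∀ n : ℕ, e (-n) = lowerLadder T v n := by
    refine ⟨fun k => if 0 ≤ k then (P ^ k.toNat) v else lowerLadder T v (-k).toNat,
      fun n => by simp, fun n => ?_⟩
    rcases n with _ | n
    · simp [lowerLadder]
    · have h : ¬ (0 : ℤ) ≤ -((n + 1 : ℕ) : ℤ) := by omega
      simp only [if_neg h, neg_neg, Int.toNat_natCast]
  have hP : ∀ k, P (e k) = e (k + 1) := by
    intro k
    obtain ⟨n, rfl | rfl⟩ := k.eq_nat_or_neg
    · have h := hpos (n + 1)
      push_cast at h
      rw [h, hpos, pow_succ', Module.End.mul_apply]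
    · rcases n with _ | n
      · simpa using (congrArg P (hpos 0)).trans (by simpa using (hpos 1).symm)
      · have h : (-((n + 1 : ℕ) : ℤ)) + 1 = -(n : ℤ) := by push_cast; ring
        rw [h, hneg, hneg, apply_lowerLadder_succ hTP hv]
  have hT : ∀ n : ℕ, T (e (-n)) = e (-n - 1) - ((-n : ℤ) : K) • e (-n) := by
    intro n
    have h : (-(n : ℤ) - 1) = -((n + 1 : ℕ) : ℤ) := by push_cast; ring
    rw [h, hneg, hneg, lowerLadder]
    push_cast
    module
  have hT' : ∀ n : ℕ, T (e n) = e (n - 1) - ((n : ℤ) : K) • e n := by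
    intro n
    induction n with
    | zero => simpa using hT 0
    | succ n ih =>
      have h1 : ((n + 1 : ℕ) : ℤ) = (n : ℤ) + 1 := by push_cast; ring
      rw [h1, ← hP, hTP, ih, map_sub, map_smul, hP, hP, sub_add_cancel, add_sub_cancel_right]
      push_cast
      module
  refine ⟨e, by simpa using hpos 0, hP, fun k => ?_⟩
  obtain ⟨n, rfl | rfl⟩ := k.eq_nat_or_neg
  · exact hT' n
  · exact hT n

variable [CharZero K] {P T : V →ₗ[K] V} {e : ℤ → V}

/-- An invariant subspace containing a combination of ladder vectors with nonzero coefficients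
contains a ladder vector: `P T - 1 + b P` sends `e_k` to `(b - k) e_{k+1}`. -/
theorem exists_ladder_mem_of_sum_mem (hP : ∀ k, P (e k) = e (k + 1))
    (hT : ∀ k : ℤ, T (e k) = e (k - 1) - (k : K) • e k) {W : Submodule K V}
    (hWP : ∀ x ∈ W, P x ∈ W) (hWT : ∀ x ∈ W, T x ∈ W) (s : Finset ℤ) :
    ∀ (m : ℤ) (c : ℤ → K), s.Nonempty → (∀ k ∈ s, c k ≠ 0) →
      ∑ k ∈ s, c k • e (k + m) ∈ W → ∃ n, e n ∈ W := by
  induction s using Finset.induction_on with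
  | empty => intro _ _ h; simp at h
  | insert b s hb ih =>
    intro m c _ hc hmem
    rcases s.eq_empty_or_nonempty with rfl | hs
    · refine ⟨b + m, ?_⟩
      have h := hc b (by simp)
      simpa [Submodule.smul_mem_iff _ h] using hmem
    · refine ih (m + 1) (fun k => ((b - k : ℤ) : K) * c k) hs (fun k hk => ?_) ?_
      · refine mul_ne_zero (Int.cast_ne_zero.mpr (sub_ne_zero.mpr ?_)) (hc k (by simp [hk]))
        rintro rfl
        exact hb hk
      · have key : ∀ k : ℤ, P (T (e (k + m))) - e (k + m) + ((b + m : ℤ) : K) • P (e (k + m)) =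
            ((b - k : ℤ) : K) • e (k + (m + 1)) := by
          intro k
          rw [hT, map_sub, map_smul, hP, hP, sub_add_cancel, ← add_assoc]
          push_cast
          module
        have h := W.add_mem (W.sub_mem (hWP _ (hWT _ hmem)) hmem)
          (W.smul_mem ((b + m : ℤ) : K) (hWP _ hmem))
        convert h using 1
        have hsum : ∀ k, ((((b - k : ℤ) : K) * c k) • e (k + (m + 1))) =
            c k • (P (T (e (k + m))) - e (k + m) + ((b + m : ℤ) : K) • P (e (k + m))) := by
          intro k
          rw [key, smul_smul, mul_comm]
        have hins : ∑ k ∈ s, (((b - k : ℤ) : K) * c k) • e (k + (m + 1)) =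
            ∑ k ∈ insert b s, (((b - k : ℤ) : K) * c k) • e (k + (m + 1)) := by
          simp [Finset.sum_insert hb]
        rw [hins, Finset.sum_congr rfl fun k _ => hsum k]
        simp only [map_sum, map_smul, Finset.smul_sum, ← Finset.sum_sub_distrib,
          ← Finset.sum_add_distrib]
        refine Finset.sum_congr rfl fun k _ => ?_
        module

/-- A nonzero invariant subspace of the span of a ladder contains the whole ladder. -/
theorem ladder_mem_of_ne_bot (hP : ∀ k, P (e k) = e (k + 1))
    (hT : ∀ k : ℤ, T (e k) = e (k - 1) - (k : K) • e k) {W : Submodule K V}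
    (hWP : ∀ x ∈ W, P x ∈ W) (hWT : ∀ x ∈ W, T x ∈ W)
    (hle : W ≤ Submodule.span K (Set.range e)) (hne : W ≠ ⊥) (k : ℤ) : e k ∈ W := by
  obtain ⟨w, hw, hw0⟩ := W.exists_mem_ne_zero_of_ne_bot hne
  obtain ⟨c, rfl⟩ := Finsupp.mem_span_range_iff_exists_finsupp.mp (hle hw)
  have hc : c.support.Nonempty := by
    rw [Finsupp.support_nonempty_iff]
    rintro rfl
    simp at hw0
  obtain ⟨n, hn⟩ := exists_ladder_mem_of_sum_mem hP hT hWP hWT c.support 0 c hc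
    (fun k hk => Finsupp.mem_support_iff.mp hk) (by simpa [Finsupp.sum] using hw)
  induction k using Int.inductionOn' (b := n) with
  | zero => exact hn
  | succ k _ ih => exact hP k ▸ hWP _ ih
  | pred k _ ih =>
    have h : e (k - 1) = T (e k) + (k : K) • e k := by rw [hT]; abel
    exact h ▸ W.add_mem (hWT _ ih) (W.smul_mem _ ih)

end LadderBasis

section Relations

variable {K : Type*} [Field K] {E : ℤ → (((ℤ ⊕ ℤ) →₀ K) →ₗ[K] ((ℤ ⊕ ℤ) →₀ K))}

theorem linearMap_ext_vv_uu {f g : ((ℤ ⊕ ℤ) →₀ K) →ₗ[K] ((ℤ ⊕ ℤ) →₀ K)}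
    (hv : ∀ k, f (vv K k) = g (vv K k)) (hu : ∀ k, f (uu K k) = g (uu K k)) : f = g := by
  refine Finsupp.lhom_ext' fun i => LinearMap.ext_ring ?_
  rcases i with k | k
  · exact hv k
  · exact hu k

/-- The commutation relation `E_0 E_{-1} = E_{-1} E_0 - E_{-1}`. -/
theorem E_zero_E_neg_one
    (hEv : ∀ n k : ℤ, E n (vv K k) = (k : K) • vv K (n + k) + uu K (n + k))
    (hEu : ∀ n k : ℤ, E n (uu K k) = (k : K) • uu K (n + k) + vv K (n + k + 1))
    (x : (ℤ ⊕ ℤ) →₀ K) : E 0 (E (-1) x) = E (-1) (E 0 x) - E (-1) x := by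
  suffices h : E 0 ∘ₗ E (-1) = E (-1) ∘ₗ E 0 - E (-1) from LinearMap.congr_fun h x
  refine linearMap_ext_vv_uu (fun k => ?_) fun k => ?_ <;>
  · simp only [LinearMap.comp_apply, LinearMap.sub_apply, hEv, hEu, map_add, map_smul, zero_add]
    simp only [← add_assoc]
    push_cast
    module

/-- The Casimir relation `E_1 E_{-1} = E_0² - E_0`. -/
theorem E_one_E_neg_one
    (hEv : ∀ n k : ℤ, E n (vv K k) = (k : K) • vv K (n + k) + uu K (n + k))
    (hEu : ∀ n k : ℤ, E n (uu K k) = (k : K) • uu K (n + k) + vv K (n + k + 1))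
    (x : (ℤ ⊕ ℤ) →₀ K) : E 1 (E (-1) x) = E 0 (E 0 x) - E 0 x := by
  suffices h : E 1 ∘ₗ E (-1) = E 0 ∘ₗ E 0 - E 0 from LinearMap.congr_fun h x
  refine linearMap_ext_vv_uu (fun k => ?_) fun k => ?_ <;>
  · simp only [LinearMap.comp_apply, LinearMap.sub_apply, hEv, hEu, map_add, map_smul, zero_add]
    simp only [← add_assoc, add_neg_cancel, zero_add]
    push_cast
    module

end Relations

/-- `M` is a simple `sl₂`-module: every nonzero subspace of `M` invariant under
`E_{-1}`, `E_0` and `E_1` equals `M`. -/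
theorem Nzero_M_simple (K : Type*) [Field K] [CharZero K] [IsAlgClosed K]
    (E : ℤ → (((ℤ ⊕ ℤ) →₀ K) →ₗ[K] ((ℤ ⊕ ℤ) →₀ K)))
    (hEv : ∀ n k : ℤ, E n (vv K k) = (k : K) • vv K (n + k) + uu K (n + k))
    (hEu : ∀ n k : ℤ, E n (uu K k) = (k : K) • uu K (n + k) + vv K (n + k + 1)) :
    ∀ W : Submodule K ((ℤ ⊕ ℤ) →₀ K),
      W ≤ Msub K E → W ≠ ⊥ →
      (∀ i ∈ ({-1, 0, 1} : Set ℤ), ∀ x ∈ W, E i x ∈ W) →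
      W = Msub K E := by
  intro W hWM hne hW
  have hv : E (-1) (E 0 (vv K 0)) = vv K 0 := by
    simp [hEv, hEu]
  obtain ⟨e, he0, hP, hT⟩ := exists_ladder (E_zero_E_neg_one hEv hEu) hv
  set S := Submodule.span K (Set.range e) with hS
  have hmem : ∀ k, e k ∈ S := fun k => Submodule.subset_span ⟨k, rfl⟩
  have hinv : ∀ f : ((ℤ ⊕ ℤ) →₀ K) →ₗ[K] ((ℤ ⊕ ℤ) →₀ K), (∀ k, f (e k) ∈ S) →
      ∀ x ∈ S, f x ∈ S := by
    intro f hf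
    have h : S ≤ S.comap f := by
      conv_lhs => rw [hS]
      rw [Submodule.span_le]
      rintro _ ⟨k, rfl⟩
      exact hf k
    exact h
  have hPS := hinv (E (-1)) fun k => hP k ▸ hmem _
  have hTS := hinv (E 0) fun k => hT k ▸ S.sub_mem (hmem _) (S.smul_mem _ (hmem _))
  have hQS := hinv (E 1) fun k => by
    have h := E_one_E_neg_one hEv hEu (e (k - 1))
    rw [hP, sub_add_cancel] at h
    rw [h]
    exact S.sub_mem (hTS _ (hTS _ (hmem _))) (hTS _ (hmem _))
  have hMS : Msub K E ≤ S := by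
    refine sInf_le ⟨he0 ▸ hmem 0, ?_⟩
    rintro i (rfl | rfl | rfl)
    exacts [hPS, hTS, hQS]
  refine le_antisymm hWM (sInf_le ⟨?_, hW⟩)
  exact he0 ▸ ladder_mem_of_ne_bot hP hT (hW (-1) (by simp)) (hW 0 (by simp))
    (hWM.trans hMS) hne 0
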